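/- Let p be a prime, H an elementary abelian p-group of rank at most four (i.e., H ≅ (Z/pZ)^r with 1 ≤ r ≤ 4), and F_q a finite field of characteristic different from p. Then H is a CI-group with respect to semisimple group codes: for any two right ideals I, J of F_q[H] with J = I^g for some permutation g of H, there exists a group automorphism σ of H (acting as a permutation of H) with J = I^σ. -/

import Mathlib

/-- Convolution product on the group algebra `F[H]`. -/
def convolve {H F : Type*} [Group H] [Fintype H] [Field F] (f g : H → F) : H → F :=
  fun x => ∑ y : H, f y * g (y⁻¹ * x)

/-- Action of a permutation `g` on functions: `f^g (x) = f (x^{g⁻¹})`. -/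
def permAct {Ω F : Type*} (g : Equiv.Perm Ω) (f : Ω → F) : Ω → F :=
  fun x => f (g.symm x)

/-- A submodule of `F[H]` is a right ideal if it is closed under right convolution. -/
def IsRightIdeal {H F : Type*} [Group H] [Fintype H] [Field F]
    (I : Submodule F (H → F)) : Prop :=
  ∀ a ∈ I, ∀ b : H → F, convolve a b ∈ I

/-- A group `G` acts on the `𝔽_p`-space `V` so that its image contains all translations of `V` as
well as all translations of `U` transported along the bijection `φ : U ≃ V`. -/
structure BiregularAction (p : ℕ) {G U V : Type*} [Group G] [AddCommGroup U] [AddCommGroup V]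
    (ρ : G →* Equiv.Perm V) (φ : U ≃ V) : Prop where
  isPGroup : IsPGroup p G
  apply_zero : φ 0 = 0
  exists_translation : ∀ v, ∃ g, ∀ x, ρ g x = v + x
  exists_conj_translation : ∀ u, ∃ g, ∀ x, ρ g (φ x) = φ (u + x)

/-- Two points lie in the same orbit of the stabilizer of `0`. -/
def StabRel {G V : Type*} [Group G] [AddCommGroup V] (ρ : G →* Equiv.Perm V) (x y : V) : Prop :=
  ∃ g, ρ g 0 = 0 ∧ ρ g x = y

/-- A subspace which is mapped into itself by the stabilizer of `0`. -/
def StabInvariant {p : ℕ} {G V : Type*} [Group G] [AddCommGroup V] [Module (ZMod p) V]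
    (ρ : G →* Equiv.Perm V) (W : Submodule (ZMod p) V) : Prop :=
  ∀ g, ρ g 0 = 0 → ∀ w ∈ W, ρ g w ∈ W

/-- An additively closed subset of an `𝔽_p`-space, as a subspace. -/
def submoduleOfAddClosed {p : ℕ} [Fact p.Prime] {V : Type*} [AddCommGroup V] [Module (ZMod p) V]
    (S : Set V) (zero : 0 ∈ S) (add : ∀ x ∈ S, ∀ y ∈ S, x + y ∈ S) : Submodule (ZMod p) V where
  carrier := S
  zero_mem' := zero
  add_mem' := fun {x y} hx hy => add x hx y hy
  smul_mem' := by
    intro c x hx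
    have hn : ∀ n : ℕ, n • x ∈ S := by
      intro n
      induction n with
      | zero => simpa using zero
      | succ n ih => rw [succ_nsmul]; exact add _ ih _ hx
    rw [← ZMod.natCast_zmod_val c, Nat.cast_smul_eq_nsmul]
    exact hn _

/-- A map between `𝔽_p`-spaces which respects addition, as a linear map. -/
def linearMapOfAdd {p : ℕ} {U V : Type*} [AddCommGroup U] [AddCommGroup V]
    [Module (ZMod p) U] [Module (ZMod p) V] (f : U → V) (hf : ∀ x y, f (x + y) = f x + f y) :
    U →ₗ[ZMod p] V :=
  (AddMonoidHom.mk' f hf).toZModLinearMap p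

namespace StabRel

variable {G V : Type*} [Group G] [AddCommGroup V] {ρ : G →* Equiv.Perm V} {x y z : V}

theorem refl (x : V) : StabRel ρ x x := ⟨1, by simp, by simp⟩

theorem symm (h : StabRel ρ x y) : StabRel ρ y x := by
  obtain ⟨g, h0, rfl⟩ := h
  refine ⟨g⁻¹, ?_, by simp⟩
  rw [map_inv, Equiv.Perm.inv_eq_iff_eq, h0]

theorem trans (h : StabRel ρ x y) (h' : StabRel ρ y z) : StabRel ρ x z := by
  obtain ⟨g, h0, rfl⟩ := h
  obtain ⟨g', h0', rfl⟩ := h'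
  exact ⟨g' * g, by simp [h0, h0'], by simp⟩

end StabRel

namespace BiregularAction

set_option linter.unusedSectionVars false

variable {p : ℕ} [Fact p.Prime] {G U V : Type*} [Group G] [AddCommGroup U] [AddCommGroup V]
  [Module (ZMod p) U] [Module (ZMod p) V] {ρ : G →* Equiv.Perm V} {φ : U ≃ V}

theorem exists_sub (h : BiregularAction p ρ φ) (g : G) (x : V) :
    ∃ g', ρ g' 0 = 0 ∧ ∀ v, ρ g' v = ρ g (x + v) - ρ g x := by
  obtain ⟨s, hs⟩ := h.exists_translation x
  obtain ⟨t, ht⟩ := h.exists_translation (-ρ g x)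
  exact ⟨t * g * s, by simp [hs, ht], fun v => by simp [hs, ht]; abel⟩

theorem exists_sub_map (h : BiregularAction p ρ φ) (u : U) :
    ∃ g, ρ g 0 = 0 ∧ ∀ x, ρ g (φ x) = φ (u + x) - φ u := by
  obtain ⟨b, hb⟩ := h.exists_conj_translation u
  obtain ⟨t, ht⟩ := h.exists_translation (-φ u)
  refine ⟨t * b, ?_, fun x => by simp [hb, ht]; abel⟩
  have := hb 0
  rw [h.apply_zero] at this
  simp [ht, this]

theorem map_sub_map_mem_iff (h : BiregularAction p ρ φ) {W : Submodule (ZMod p) V}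
    (hW : StabInvariant ρ W) (g : G) (x y : V) : ρ g x - ρ g y ∈ W ↔ x - y ∈ W := by
  have key : ∀ (g : G) (x y : V), x - y ∈ W → ρ g x - ρ g y ∈ W := by
    intro g x y hxy
    obtain ⟨g', h0, hg'⟩ := h.exists_sub g y
    have := hW g' h0 _ hxy
    rw [hg'] at this
    simpa using this
  refine ⟨fun hxy => ?_, key g x y⟩
  simpa using key g⁻¹ _ _ hxy

theorem stabInvariant_mem_iff {W : Submodule (ZMod p) V} (hW : StabInvariant ρ W) {x y : V}
    (hxy : StabRel ρ x y) : x ∈ W ↔ y ∈ W := by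
  constructor
  · obtain ⟨g, h0, rfl⟩ := hxy
    exact hW g h0 x
  · obtain ⟨g, h0, rfl⟩ := hxy.symm
    exact hW g h0 y

theorem exists_preimage (h : BiregularAction p ρ φ) {W : Submodule (ZMod p) V}
    (hW : StabInvariant ρ W) : ∃ W' : Submodule (ZMod p) U, ∀ u, u ∈ W' ↔ φ u ∈ W := by
  refine ⟨submoduleOfAddClosed {u | φ u ∈ W} (by simp [h.apply_zero]) ?_, fun u => Iff.rfl⟩
  intro x hx y hy
  obtain ⟨g, h0, hg⟩ := h.exists_sub_map x
  have := W.add_mem (hW g h0 _ hy) hx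
  rw [hg] at this
  simpa using this

theorem sub_mem_iff (h : BiregularAction p ρ φ) {W : Submodule (ZMod p) V}
    (hW : StabInvariant ρ W) {W' : Submodule (ZMod p) U} (hW' : ∀ u, u ∈ W' ↔ φ u ∈ W) (x y : U) :
    x - y ∈ W' ↔ φ x - φ y ∈ W := by
  obtain ⟨g, h0, hg⟩ := h.exists_sub_map y
  have h1 : StabRel ρ (φ (x - y)) (φ x - φ y) := ⟨g, h0, by rw [hg]; simp⟩
  rw [hW', stabInvariant_mem_iff hW h1]

/-- The points which the stabilizer of `0` fixes modulo an invariant subspace. -/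
def fixedModulo (h : BiregularAction p ρ φ) (W : Submodule (ZMod p) V) :
    Submodule (ZMod p) V :=
  submoduleOfAddClosed {v | ∀ g, ρ g 0 = 0 → ρ g v - v ∈ W} (by simp +contextual) (by
    intro x hx y hy g h0
    obtain ⟨g', h0', hg'⟩ := h.exists_sub g x
    have := W.add_mem (hy g' h0') (hx g h0)
    rw [hg'] at this
    convert this using 1
    abel)

theorem mem_fixedModulo (h : BiregularAction p ρ φ) {W : Submodule (ZMod p) V} {v : V} :
    v ∈ h.fixedModulo W ↔ ∀ g, ρ g 0 = 0 → ρ g v - v ∈ W := Iff.rfl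

theorem le_fixedModulo (h : BiregularAction p ρ φ) {W : Submodule (ZMod p) V}
    (hW : StabInvariant ρ W) : W ≤ h.fixedModulo W :=
  fun w hw g h0 => W.sub_mem (hW g h0 w hw) hw

theorem stabInvariant_of_le (h : BiregularAction p ρ φ) {W D : Submodule (ZMod p) V}
    (hWD : W ≤ D) (hD : D ≤ h.fixedModulo W) : StabInvariant ρ D := by
  intro g h0 w hw
  have := D.add_mem (hWD (hD hw g h0)) hw
  simpa using this

theorem map_add_sub_mem (h : BiregularAction p ρ φ) {W : Submodule (ZMod p) V} {v : V}
    (hv : v ∈ h.fixedModulo W) (g : G) (x : V) : ρ g (x + v) - ρ g x - v ∈ W := by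
  obtain ⟨g', h0', hg'⟩ := h.exists_sub g x
  simpa [hg'] using hv g' h0'

theorem map_add_sub_map_mem (h : BiregularAction p ρ φ) {W : Submodule (ZMod p) V} {u : U}
    (hu : φ u ∈ h.fixedModulo W) (x : U) : φ (x + u) - φ x - φ u ∈ W := by
  obtain ⟨g', h0', hg'⟩ := h.exists_sub_map x
  simpa [hg'] using hu g' h0'

theorem mem_fixedModulo_bot (h : BiregularAction p ρ φ) {v : V} :
    v ∈ h.fixedModulo ⊥ ↔ ∀ g, ρ g 0 = 0 → ρ g v = v := by
  simp [mem_fixedModulo, sub_eq_zero]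

/-- The action induced on the quotient by an invariant subspace. -/
noncomputable def quotientHom (h : BiregularAction p ρ φ) (W : Submodule (ZMod p) V)
    (hW : StabInvariant ρ W) : G →* Equiv.Perm (V ⧸ W) where
  toFun g := Quotient.congr (ρ g) fun x y => by
    rw [Submodule.quotientRel_def, Submodule.quotientRel_def, h.map_sub_map_mem_iff hW]
  map_one' := by
    ext x
    obtain ⟨x, rfl⟩ := W.mkQ_surjective x
    change W.mkQ (ρ 1 x) = W.mkQ x
    simp
  map_mul' g g' := by
    ext x
    obtain ⟨x, rfl⟩ := W.mkQ_surjective x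
    change W.mkQ (ρ (g * g') x) = W.mkQ (ρ g (ρ g' x))
    simp

theorem quotientHom_mkQ (h : BiregularAction p ρ φ) (W : Submodule (ZMod p) V)
    (hW : StabInvariant ρ W) (g : G) (x : V) :
    h.quotientHom W hW g (W.mkQ x) = W.mkQ (ρ g x) := rfl

/-- The bijection induced on the quotients by corresponding invariant subspaces. -/
noncomputable def quotientEquiv (h : BiregularAction p ρ φ) {W : Submodule (ZMod p) V}
    (hW : StabInvariant ρ W) {W' : Submodule (ZMod p) U} (hW' : ∀ u, u ∈ W' ↔ φ u ∈ W) :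
    U ⧸ W' ≃ V ⧸ W :=
  Quotient.congr φ fun x y => by
    rw [Submodule.quotientRel_def, Submodule.quotientRel_def, h.sub_mem_iff hW hW']

theorem quotientEquiv_mkQ (h : BiregularAction p ρ φ) {W : Submodule (ZMod p) V}
    (hW : StabInvariant ρ W) {W' : Submodule (ZMod p) U} (hW' : ∀ u, u ∈ W' ↔ φ u ∈ W) (x : U) :
    h.quotientEquiv hW hW' (W'.mkQ x) = W.mkQ (φ x) := rfl

theorem quotient (h : BiregularAction p ρ φ) {W : Submodule (ZMod p) V}
    (hW : StabInvariant ρ W) {W' : Submodule (ZMod p) U} (hW' : ∀ u, u ∈ W' ↔ φ u ∈ W) :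
    BiregularAction p (h.quotientHom W hW) (h.quotientEquiv hW hW') where
  isPGroup := h.isPGroup
  apply_zero := by
    rw [← map_zero W'.mkQ, quotientEquiv_mkQ, h.apply_zero, map_zero]
  exists_translation v := by
    obtain ⟨v, rfl⟩ := W.mkQ_surjective v
    obtain ⟨g, hg⟩ := h.exists_translation v
    refine ⟨g, fun x => ?_⟩
    obtain ⟨x, rfl⟩ := W.mkQ_surjective x
    rw [quotientHom_mkQ, hg, map_add]
  exists_conj_translation u := by
    obtain ⟨u, rfl⟩ := W'.mkQ_surjective u
    obtain ⟨g, hg⟩ := h.exists_conj_translation u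
    refine ⟨g, fun x => ?_⟩
    obtain ⟨x, rfl⟩ := W'.mkQ_surjective x
    rw [quotientEquiv_mkQ, quotientHom_mkQ, hg, ← map_add, quotientEquiv_mkQ]

theorem exists_of_quotient_stabRel (h : BiregularAction p ρ φ) {W : Submodule (ZMod p) V}
    (hW : StabInvariant ρ W) {x y : V}
    (hxy : StabRel (h.quotientHom W hW) (W.mkQ x) (W.mkQ y)) :
    ∃ w ∈ W, StabRel ρ x (y + w) := by
  obtain ⟨g, h0, hg⟩ := hxy
  rw [← map_zero W.mkQ, quotientHom_mkQ, ← sub_eq_zero, ← map_sub, Submodule.mkQ_apply,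
    Submodule.Quotient.mk_eq_zero, sub_zero] at h0
  rw [quotientHom_mkQ, ← sub_eq_zero, ← map_sub, Submodule.mkQ_apply,
    Submodule.Quotient.mk_eq_zero] at hg
  obtain ⟨t, ht⟩ := h.exists_translation (-ρ g 0)
  exact ⟨(ρ g x - y) - ρ g 0, W.sub_mem hg h0, t * g, by simp [ht], by simp [ht]; abel⟩

/-- The elements of `G` preserving a subspace. -/
def setStabilizer (ρ : G →* Equiv.Perm V) (W : Submodule (ZMod p) V) : Subgroup G where
  carrier := {g | ∀ v, ρ g v ∈ W ↔ v ∈ W}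
  one_mem' := by simp
  mul_mem' := by
    intro a b ha hb v
    rw [map_mul, Equiv.Perm.mul_apply, ha, hb]
  inv_mem' := by
    intro a ha v
    rw [← ha]
    simp

/-- The action of the elements preserving a subspace on that subspace. -/
def restrictHom (ρ : G →* Equiv.Perm V) (W : Submodule (ZMod p) V) :
    setStabilizer ρ W →* Equiv.Perm W where
  toFun g := (ρ g).subtypePerm g.2
  map_one' := by ext; simp
  map_mul' a b := by
    ext x
    change ρ (a.1 * b.1) x = _
    rw [map_mul]
    rfl

/-- The bijection between corresponding invariant subspaces. -/
def restrictEquiv (φ : U ≃ V) {W : Submodule (ZMod p) V} {W' : Submodule (ZMod p) U}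
    (hW' : ∀ u, u ∈ W' ↔ φ u ∈ W) : W' ≃ W :=
  φ.subtypeEquiv hW'

theorem restrict (h : BiregularAction p ρ φ) {W : Submodule (ZMod p) V}
    {W' : Submodule (ZMod p) U} (hW' : ∀ u, u ∈ W' ↔ φ u ∈ W) :
    BiregularAction p (restrictHom ρ W) (restrictEquiv φ hW') where
  isPGroup := h.isPGroup.to_subgroup _
  apply_zero := Subtype.ext h.apply_zero
  exists_translation v := by
    obtain ⟨g, hg⟩ := h.exists_translation v
    refine ⟨⟨g, fun x => ?_⟩, fun x => Subtype.ext (hg x)⟩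
    rw [hg, W.add_mem_iff_right v.2]
  exists_conj_translation u := by
    obtain ⟨g, hg⟩ := h.exists_conj_translation u
    refine ⟨⟨g, fun x => ?_⟩, fun x => Subtype.ext (hg x)⟩
    obtain ⟨x, rfl⟩ := φ.surjective x
    rw [hg, ← hW', ← hW', W'.add_mem_iff_right u.2]

theorem stabRel_of_restrict {W : Submodule (ZMod p) V} {x y : W}
    (hxy : StabRel (restrictHom ρ W) x y) : StabRel ρ (x : V) (y : V) := by
  obtain ⟨g, h0, hg⟩ := hxy
  exact ⟨g, congrArg Subtype.val h0, congrArg Subtype.val hg⟩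

theorem exists_mem_fixedModulo [Finite V] (h : BiregularAction p ρ φ) {W : Submodule (ZMod p) V}
    (hW : StabInvariant ρ W) (hne : W ≠ ⊤) : ∃ v ∈ h.fixedModulo W, v ∉ W := by
  let S : Subgroup G := (MulAction.stabilizer (Equiv.Perm V) (0 : V)).comap ρ
  let _ : MulAction S (V ⧸ W) :=
    MulAction.compHom (V ⧸ W) ((h.quotientHom W hW).comp S.subtype)
  have hsmul : ∀ (g : S) (x : V), g • W.mkQ x = W.mkQ (ρ g x) := fun g x => rfl
  have hcard : p ∣ Nat.card (V ⧸ W) := by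
    rw [Module.natCard_eq_pow_finrank (K := ZMod p), Nat.card_zmod]
    refine dvd_pow_self p (Nat.pos_iff_ne_zero.mp ?_)
    have := Submodule.Quotient.nontrivial_iff.mpr hne
    exact Module.finrank_pos
  have h0 : W.mkQ 0 ∈ MulAction.fixedPoints S (V ⧸ W) := fun g => by
    rw [hsmul, show ρ g 0 = 0 from g.2]
  have : Finite (V ⧸ W) := Finite.of_surjective _ W.mkQ_surjective
  obtain ⟨b, hb, hne⟩ :=
    (h.isPGroup.to_subgroup S).exists_fixed_point_of_prime_dvd_card_of_fixed_point
      (V ⧸ W) hcard h0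
  obtain ⟨v, rfl⟩ := W.mkQ_surjective b
  refine ⟨v, fun g hg => ?_, fun hv => hne ?_⟩
  · have := hb ⟨g, hg⟩
    rwa [hsmul, ← sub_eq_zero, ← map_sub, Submodule.mkQ_apply,
      Submodule.Quotient.mk_eq_zero] at this
  · rw [map_zero, eq_comm, Submodule.mkQ_apply, Submodule.Quotient.mk_eq_zero]
    exact hv

theorem lt_fixedModulo [Finite V] (h : BiregularAction p ρ φ) {W : Submodule (ZMod p) V}
    (hW : StabInvariant ρ W) (hne : W ≠ ⊤) : W < h.fixedModulo W := by
  obtain ⟨v, hv, hv'⟩ := h.exists_mem_fixedModulo hW hne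
  exact lt_of_le_of_ne (h.le_fixedModulo hW) fun e => hv' (e ▸ hv)

theorem apply_add_of_fixed (h : BiregularAction p ρ φ) {v : V} (hv : v ∈ h.fixedModulo ⊥)
    (g : G) (x : V) : ρ g (x + v) = ρ g x + v := by
  have := h.map_add_sub_mem hv g x
  rw [Submodule.mem_bot, sub_eq_zero, sub_eq_iff_eq_add'] at this
  exact this

theorem apply_add_of_map_fixed (h : BiregularAction p ρ φ) {u : U}
    (hu : φ u ∈ h.fixedModulo ⊥) (x : U) : φ (x + u) = φ x + φ u := by
  have := h.map_add_sub_map_mem hu x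
  rw [Submodule.mem_bot, sub_eq_zero, sub_eq_iff_eq_add'] at this
  exact this

theorem stabInvariant_of_le_fixed (h : BiregularAction p ρ φ) {W : Submodule (ZMod p) V}
    (hW : W ≤ h.fixedModulo ⊥) : StabInvariant ρ W :=
  h.stabInvariant_of_le bot_le hW

/-- The points fixed by all elements of the stabilizer of `0` acting trivially on `V ⧸ C`. -/
def kernelFixed (h : BiregularAction p ρ φ) (C : Submodule (ZMod p) V) :
    Submodule (ZMod p) V :=
  submoduleOfAddClosed {v | ∀ g, ρ g 0 = 0 → (∀ x, ρ g x - x ∈ C) → ρ g v = v}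
    (fun g h0 _ => h0) (by
    intro x hx y hy g h0 hg
    obtain ⟨g', h0', hg'⟩ := h.exists_sub g x
    rw [hx g h0 hg] at hg'
    have := hy g' h0' fun v => by
      rw [hg']
      convert hg (x + v) using 1
      abel
    rw [hg', sub_eq_iff_eq_add'] at this
    exact this)

theorem mem_kernelFixed (h : BiregularAction p ρ φ) {C : Submodule (ZMod p) V} {v : V} :
    v ∈ h.kernelFixed C ↔ ∀ g, ρ g 0 = 0 → (∀ x, ρ g x - x ∈ C) → ρ g v = v := Iff.rfl

theorem fixed_le_kernelFixed (h : BiregularAction p ρ φ) (C : Submodule (ZMod p) V) :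
    h.fixedModulo ⊥ ≤ h.kernelFixed C :=
  fun _ hv g h0 _ => h.mem_fixedModulo_bot.mp hv g h0

theorem stabInvariant_kernelFixed (h : BiregularAction p ρ φ) {C : Submodule (ZMod p) V}
    (hC : C ≤ h.fixedModulo ⊥) : StabInvariant ρ (h.kernelFixed C) := by
  intro k k0 v hv g h0 hg
  have hk0 : ρ k⁻¹ 0 = 0 := by rw [map_inv, Equiv.Perm.inv_eq_iff_eq, k0]
  have := hv (k⁻¹ * g * k) (by simp only [map_mul, Equiv.Perm.mul_apply, k0, h0, hk0]) (by
    intro x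
    have hx := hg (ρ k x)
    have : ρ (k⁻¹ * g * k) x = x + (ρ g (ρ k x) - ρ k x) := by
      rw [map_mul, map_mul, Equiv.Perm.mul_apply, Equiv.Perm.mul_apply]
      conv_lhs => rw [← add_sub_cancel (ρ k x) (ρ g (ρ k x))]
      rw [h.apply_add_of_fixed (hC hx)]
      simp
    rw [this]
    simpa using hx)
  rw [map_mul, map_mul, Equiv.Perm.mul_apply, Equiv.Perm.mul_apply, map_inv,
    Equiv.Perm.inv_eq_iff_eq] at this
  exact this

theorem stabRel_add_of_notMem_kernelFixed (h : BiregularAction p ρ φ) {c : V}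
    (hc : c ∈ h.fixedModulo ⊥) {v : V} (hv : v ∉ h.kernelFixed (ZMod p ∙ c)) {z : V}
    (hz : z ∈ ZMod p ∙ c) : StabRel ρ v (v + z) := by
  rw [mem_kernelFixed] at hv
  push Not at hv
  obtain ⟨g, h0, hg, hne⟩ := hv
  obtain ⟨a, ha⟩ := Submodule.mem_span_singleton.mp (hg v)
  obtain ⟨b, rfl⟩ := Submodule.mem_span_singleton.mp hz
  have ha0 : a ≠ 0 := by
    rintro rfl
    rw [zero_smul, eq_comm, sub_eq_zero] at ha
    exact hne ha
  have hpow : ∀ n : ℕ, ρ (g ^ n) 0 = 0 ∧ ρ (g ^ n) v = v + n • (a • c) := by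
    intro n
    induction n with
    | zero => simp
    | succ n ih =>
      rw [pow_succ', map_mul, Equiv.Perm.mul_apply, Equiv.Perm.mul_apply, ih.1, ih.2,
        h.apply_add_of_fixed (nsmul_mem (Submodule.smul_mem _ _ hc) n), ha]
      exact ⟨h0, by rw [succ_nsmul]; abel⟩
  refine ⟨g ^ (b / a).val, (hpow _).1, ?_⟩
  rw [(hpow _).2, ← Nat.cast_smul_eq_nsmul (ZMod p), ZMod.natCast_zmod_val, smul_smul,
    div_mul_cancel₀ _ ha0]

/-- A linear map `τ` which agrees with `φ` modulo `C` up to orbits of the stabilizer of `0` can be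
changed modulo `C` so that it agrees with `φ` up to orbits. -/
def LiftsLinear (ρ : G →* Equiv.Perm V) (φ : U ≃ V) (C : Submodule (ZMod p) V) : Prop :=
  ∀ τ : U →ₗ[ZMod p] V, (∀ u, ∃ y ∈ C, StabRel ρ (φ u) (τ u + y)) →
    ∃ σ : U →ₗ[ZMod p] V, ∀ u, σ u - τ u ∈ C ∧ StabRel ρ (φ u) (σ u)

theorem exists_extend_modulo {E' : Submodule (ZMod p) U} {C : Submodule (ZMod p) V}
    (τ : U →ₗ[ZMod p] V) (f : E' →ₗ[ZMod p] V) (hf : ∀ u : E', f u - τ u ∈ C) :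
    ∃ σ : U →ₗ[ZMod p] V, (∀ u, σ u - τ u ∈ C) ∧ ∀ u : E', σ u = f u := by
  obtain ⟨l, hl⟩ := LinearMap.exists_extend
    (LinearMap.codRestrict C (f - τ.comp E'.subtype) hf)
  refine ⟨τ + C.subtype.comp l, fun u => by simp, fun u => ?_⟩
  have := congrArg Subtype.val (LinearMap.congr_fun hl u)
  change (l u : V) = f u - τ u at this
  simp [this]

theorem liftsLinear_of_kernelFixed (h : BiregularAction p ρ φ) {c : V}
    (hc : c ∈ h.fixedModulo ⊥) {E' : Submodule (ZMod p) U}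
    (hE' : ∀ u, u ∈ E' ↔ φ u ∈ h.kernelFixed (ZMod p ∙ c))
    (hlift : LiftsLinear (restrictHom ρ (h.kernelFixed (ZMod p ∙ c))) (restrictEquiv φ hE')
      (ZMod p ∙ ⟨c, h.fixed_le_kernelFixed _ hc⟩)) :
    LiftsLinear ρ φ (ZMod p ∙ c) := by
  intro τ hτ
  set E := h.kernelFixed (ZMod p ∙ c) with hE
  have hC : (ZMod p ∙ c) ≤ h.fixedModulo ⊥ := by simpa using hc
  have hCE : (ZMod p ∙ c) ≤ E := hC.trans (h.fixed_le_kernelFixed _)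
  have hinv : StabInvariant ρ E := h.stabInvariant_kernelFixed hC
  have hτE : ∀ u : E', τ u ∈ E := by
    intro u
    obtain ⟨y, hy, hr⟩ := hτ u
    exact (E.add_mem_iff_left (hCE hy)).mp ((stabInvariant_mem_iff hinv hr).mp ((hE' _).mp u.2))
  have hmem : ∀ x : E, x ∈ (ZMod p ∙ (⟨c, hCE (by simp)⟩ : E)) ↔ (x : V) ∈ ZMod p ∙ c := by
    intro x
    simp only [Submodule.mem_span_singleton, Subtype.ext_iff, Submodule.coe_smul]
  obtain ⟨f, hf⟩ := hlift (LinearMap.codRestrict E (τ.comp E'.subtype) hτE) (by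
    intro u
    obtain ⟨y, hy, g, h0, hg⟩ := hτ u
    refine ⟨⟨y, hCE hy⟩, (hmem _).mpr hy, ⟨g, fun v => ?_⟩, Subtype.ext h0, Subtype.ext hg⟩
    have := h.map_sub_map_mem_iff hinv g v 0
    simpa [h0] using this)
  obtain ⟨σ, hσ, hσf⟩ := exists_extend_modulo (C := ZMod p ∙ c) τ (E.subtype.comp f)
    fun u => (hmem _).mp (hf u).1
  refine ⟨σ, fun u => ⟨hσ u, ?_⟩⟩
  by_cases hu : u ∈ E'
  · have := stabRel_of_restrict (hf ⟨u, hu⟩).2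
    rw [show σ u = (f ⟨u, hu⟩ : V) from hσf ⟨u, hu⟩]
    exact this
  · obtain ⟨y, hy, hr⟩ := hτ u
    have hne : τ u + y ∉ E := by
      rw [← stabInvariant_mem_iff hinv hr, ← hE']
      exact hu
    have := h.stabRel_add_of_notMem_kernelFixed hc hne (Submodule.sub_mem _ (hσ u) hy)
    refine hr.trans ?_
    convert this using 1
    abel

theorem postcomp (h : BiregularAction p ρ φ) {g : G} (h0 : ρ g 0 = 0) :
    BiregularAction p ρ (φ.trans (ρ g)) where
  isPGroup := h.isPGroup
  apply_zero := by simp [h.apply_zero, h0]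
  exists_translation := h.exists_translation
  exists_conj_translation u := by
    obtain ⟨b, hb⟩ := h.exists_conj_translation u
    exact ⟨g * b * g⁻¹, fun x => by simp [hb]⟩

theorem map_add_of_faithful (h : BiregularAction p ρ φ) {W : Submodule (ZMod p) V}
    (hf : ∀ g, ρ g 0 = 0 → (∀ x, ρ g x - x ∈ W) → ∀ x, ρ g x = x) {u : U}
    (hu : φ u ∈ h.fixedModulo W) (x : U) : φ (x + u) = φ x + φ u := by
  obtain ⟨g, h0, hg⟩ := h.exists_sub_map u
  have := hf g h0 (fun y => by
    obtain ⟨y, rfl⟩ := φ.surjective y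
    rw [hg]
    convert h.map_add_sub_map_mem hu y using 1
    rw [add_comm]
    abel) (φ x)
  rw [hg, sub_eq_iff_eq_add] at this
  rw [add_comm, this]

theorem apply_add_of_faithful (h : BiregularAction p ρ φ) {W : Submodule (ZMod p) V}
    (hW : StabInvariant ρ W)
    (hf : ∀ g, ρ g 0 = 0 → (∀ x, ρ g x - x ∈ W) → ∀ x, ρ g x = x) {d : V}
    (hd : d ∈ h.fixedModulo W) {g : G} (h0 : ρ g 0 = 0) (x : V) :
    ρ g (x + d) = ρ g x + ρ g d := by
  obtain ⟨g', h0', hg'⟩ := h.exists_sub g d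
  have := hf (g⁻¹ * g') (by
    rw [map_mul, Equiv.Perm.mul_apply, h0', map_inv, Equiv.Perm.inv_eq_iff_eq, h0]) (fun y => by
    rw [← h.map_sub_map_mem_iff hW g]
    have := W.sub_mem (h.map_add_sub_mem hd g y) (hd g h0)
    simp only [map_mul, Equiv.Perm.mul_apply, map_inv, Equiv.Perm.coe_inv, Equiv.apply_symm_apply, hg']
    convert this using 1
    rw [add_comm]
    abel) x
  rw [map_mul, Equiv.Perm.mul_apply, map_inv, Equiv.Perm.inv_eq_iff_eq, hg',
    sub_eq_iff_eq_add] at this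
  rw [add_comm, this]

theorem apply_sub_self_mem (h : BiregularAction p ρ φ) {W : Submodule (ZMod p) V}
    (hW : h.fixedModulo W = ⊤) {g : G} (h0 : ρ g 0 = 0) (x : V) : ρ g x - x ∈ W :=
  (show x ∈ h.fixedModulo W from hW ▸ Submodule.mem_top) g h0

/-- The linear map to the quotient by `W` induced by `φ`, when the stabilizer of `0` acts
trivially on that quotient. -/
def mapModulo (h : BiregularAction p ρ φ) {W : Submodule (ZMod p) V}
    (hW : h.fixedModulo W = ⊤) : U →ₗ[ZMod p] V ⧸ W :=
  linearMapOfAdd (fun u => W.mkQ (φ u)) fun x y => by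
    have := h.map_add_sub_map_mem (W := W) (u := y) (hW ▸ Submodule.mem_top) x
    rw [← Submodule.Quotient.mk_eq_zero, ← Submodule.mkQ_apply, map_sub, map_sub, sub_sub,
      sub_eq_zero] at this
    exact this

theorem stabRel_add_of_fixed (h : BiregularAction p ρ φ) {x y z : V} (hxy : StabRel ρ x y)
    (hz : z ∈ h.fixedModulo ⊥) : StabRel ρ (x + z) (y + z) := by
  obtain ⟨g, h0, rfl⟩ := hxy
  exact ⟨g, h0, h.apply_add_of_fixed hz g x⟩

theorem stabRel_map_smul (h : BiregularAction p ρ φ) {D : Submodule (ZMod p) V}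
    (hD : D ≤ h.fixedModulo ⊥) (hD' : h.fixedModulo D = ⊤) (a : ZMod p) (e : U) :
    StabRel ρ (φ (a • e)) (a • φ e) := by
  by_cases ha : a = 0
  · simp only [ha, zero_smul, h.apply_zero]
    exact StabRel.refl _
  set w := φ (a • e) with hw
  let W : Submodule (ZMod p) V := submoduleOfAddClosed {y | StabRel ρ w (w + y)}
    (by simpa using StabRel.refl w) (by
      rintro x hx y ⟨g, h0, hg⟩
      have hy : y ∈ h.fixedModulo ⊥ := by
        have := hD (h.apply_sub_self_mem hD' h0 w)
        rwa [hg, add_sub_cancel_left] at this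
      obtain ⟨g', h0', hg'⟩ := hx
      refine ⟨g' * g, by simp [h0, h0'], ?_⟩
      rw [map_mul, Equiv.Perm.mul_apply, hg, h.apply_add_of_fixed hy, hg', add_assoc])
  have hmul : ∀ t : ℕ, φ (t • a • e) - t • w ∈ W := by
    intro t
    induction t with
    | zero => simp [h.apply_zero]
    | succ t ih =>
      obtain ⟨g, h0, hg⟩ := h.exists_sub_map (t • a • e)
      have : ρ g w - w ∈ W := ⟨g, h0, by abel⟩
      convert W.add_mem ih this using 1
      rw [hg, succ_nsmul, succ_nsmul]
      abel
  have hW := W.smul_mem a (hmul (a⁻¹).val)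
  rw [← Nat.cast_smul_eq_nsmul (ZMod p), ← Nat.cast_smul_eq_nsmul (ZMod p),
    ZMod.natCast_zmod_val, smul_smul, inv_mul_cancel₀ ha, one_smul, smul_sub, smul_smul,
    mul_inv_cancel₀ ha, one_smul] at hW
  have : StabRel ρ w (w + (a • φ e - w)) := hW
  rwa [add_sub_cancel] at this

theorem exists_linear_of_faithful [Finite V] (h : BiregularAction p ρ φ) {c : V} (hc0 : c ≠ 0)
    (hc : c ∈ h.fixedModulo ⊥) (hrank : Module.finrank (ZMod p) V ≤ 3)
    (hf : ∀ g, ρ g 0 = 0 → (∀ x, ρ g x - x ∈ ZMod p ∙ c) → ∀ x, ρ g x = x)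
    (τ : U →ₗ[ZMod p] V) (hτ : ∀ u, ∃ y ∈ ZMod p ∙ c, StabRel ρ (φ u) (τ u + y))
    {e : U} (he : φ e ∉ h.fixedModulo (ZMod p ∙ c)) (heτ : φ e - τ e ∈ ZMod p ∙ c) :
    ∃ σ : U →ₗ[ZMod p] V, ∀ u, σ u - τ u ∈ ZMod p ∙ c ∧ StabRel ρ (φ u) (σ u) := by
  set C : Submodule (ZMod p) V := ZMod p ∙ c with hCdef
  set D := h.fixedModulo C with hDdef
  have hC : C ≤ h.fixedModulo ⊥ := by simpa [hCdef] using hc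
  have hCinv : StabInvariant ρ C := h.stabInvariant_of_le_fixed hC
  have hDinv : StabInvariant ρ D := h.stabInvariant_of_le (h.le_fixedModulo hCinv) le_rfl
  have hDtop : D ≠ ⊤ := fun hD => he (hD ▸ Submodule.mem_top)
  have hCtop : C ≠ ⊤ := fun hC => hDtop (top_le_iff.mp (hC ▸ h.le_fixedModulo hCinv))
  have hCD := Submodule.finrank_lt_finrank_of_lt (h.lt_fixedModulo hCinv hCtop)
  have hDV := Submodule.finrank_lt hDtop
  have hC1 : Module.finrank (ZMod p) C = 1 := finrank_span_singleton hc0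
  have hD2 : h.fixedModulo D = ⊤ := by
    have := Submodule.finrank_lt_finrank_of_lt (h.lt_fixedModulo hDinv hDtop)
    by_contra hne
    have := Submodule.finrank_lt hne
    rw [← hDdef] at hCD
    omega
  rw [← hDdef] at hCD
  obtain ⟨D', hD'⟩ := h.exists_preimage hDinv
  have hDτ : ∀ u ∈ D', φ u - τ u ∈ C := by
    intro u hu
    obtain ⟨y, hy, g, h0, hg⟩ := hτ u
    have := C.sub_mem hy ((hD' u).mp hu g h0)
    rw [hg] at this
    convert this using 1
    abel
  have hadd : ∀ x, ∀ u ∈ D', φ (x + u) = φ x + φ u := fun x u hu =>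
    h.map_add_of_faithful hf ((hD' u).mp hu) x
  have hdecomp : ∀ u, ∃ a : ZMod p, u - a • e ∈ D' := by
    intro u
    have hsup : D ⊔ (ZMod p ∙ φ e) = ⊤ := by
      by_contra hne
      have h1 := Submodule.finrank_lt hne
      have h2 : D < D ⊔ (ZMod p ∙ φ e) := by
        refine lt_of_le_of_ne le_sup_left fun heq => he ?_
        rw [heq]
        exact Submodule.mem_sup_right (Submodule.mem_span_singleton_self _)
      have := Submodule.finrank_lt_finrank_of_lt h2
      omega
    obtain ⟨d, hd, y, hy, hdy⟩ := Submodule.mem_sup.mp (hsup ▸ Submodule.mem_top : φ u ∈ _)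
    obtain ⟨a, rfl⟩ := Submodule.mem_span_singleton.mp hy
    refine ⟨a, (hD' _).mpr ?_⟩
    rw [← Submodule.Quotient.mk_eq_zero]
    change h.mapModulo hD2 (u - a • e) = 0
    rw [map_sub, map_smul]
    change D.mkQ (φ u) - a • D.mkQ (φ e) = 0
    rw [← map_smul, ← map_sub, ← hdy, add_sub_cancel_right, Submodule.mkQ_apply,
      Submodule.Quotient.mk_eq_zero]
    exact hd
  have heD' : e ∉ D' := fun hmem => he ((hD' e).mp hmem)
  obtain ⟨σ, hσ, hσe⟩ := LinearMap.exists_extend_of_notMem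
    (linearMapOfAdd (p := p) (fun u : D' => φ u) fun x y => hadd x y y.2) heD' (φ e)
  have hσD : ∀ u ∈ D', σ u = φ u := fun u hu => LinearMap.congr_fun hσ ⟨u, hu⟩
  have hσa : ∀ (a : ZMod p) (u : U), u ∈ D' → σ (a • e + u) = a • φ e + φ u := fun a u hu => by
    rw [map_add, map_smul, hσe, hσD u hu]
  suffices hsmul : ∀ a : ZMod p, ∀ u ∈ D', StabRel ρ (φ (a • e) + φ u) (a • φ e + φ u) by
    refine ⟨σ, fun u => ?_⟩
    obtain ⟨a, ha⟩ := hdecomp u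
    obtain ⟨u', hu', rfl⟩ : ∃ u' ∈ D', u = a • e + u' := ⟨_, ha, by abel⟩
    rw [hσa a u' hu', hadd _ _ hu']
    refine ⟨?_, hsmul a u' hu'⟩
    convert C.add_mem (C.smul_mem a heτ) (hDτ u' hu') using 1
    rw [map_add, map_smul, smul_sub]
    abel
  by_cases hDZ : D ≤ h.fixedModulo ⊥
  · exact fun a u hu => h.stabRel_add_of_fixed (h.stabRel_map_smul hDZ hD2 a e)
      (hDZ ((hD' u).mp hu))
  · obtain ⟨d, hd, hdZ⟩ := SetLike.not_le_iff_exists.mp hDZ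
    rw [mem_fixedModulo_bot] at hdZ
    push Not at hdZ
    obtain ⟨g, h0, hgd⟩ := hdZ
    obtain ⟨k, k0, hk⟩ := h.exists_sub_map e
    have hDadd : ∀ {g}, ρ g 0 = 0 → ∀ x, ∀ d ∈ D, ρ g (x + d) = ρ g x + ρ g d :=
      fun h0 x d hd => h.apply_add_of_faithful hCinv hf hd h0 x
    have hkD : ∀ d ∈ D, ρ k d = d := by
      intro d hd
      obtain ⟨u, rfl⟩ := φ.surjective d
      rw [hk, hadd e u ((hD' u).mpr hd), add_sub_cancel_left]
    let S : Submodule (ZMod p) V := submoduleOfAddClosed {d | d ∈ D ∧ ρ g d = d}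
      ⟨D.zero_mem, h0⟩ fun x hx y hy =>
        ⟨D.add_mem hx.1 hy.1, by rw [hDadd h0 x y hy.1, hx.2, hy.2]⟩
    have hSC : S = C := by
      have hCS : C ≤ S := fun y hy =>
        ⟨h.le_fixedModulo hCinv hy, h.mem_fixedModulo_bot.mp (hC hy) g h0⟩
      have hSD : S < D := lt_of_le_of_ne (fun y hy => hy.1) fun heq => hgd (heq ▸ hd : d ∈ S).2
      have h1 := Submodule.finrank_lt_finrank_of_lt hSD
      have h2 := Submodule.finrank_mono hCS
      exact (Submodule.eq_of_le_of_finrank_eq hCS (by omega)).symm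
    have hginv : ρ g⁻¹ 0 = 0 := by rw [map_inv, Equiv.Perm.inv_eq_iff_eq, h0]
    have hkinv : ρ k⁻¹ 0 = 0 := by rw [map_inv, Equiv.Perm.inv_eq_iff_eq, k0]
    have hcomm : ∀ x, ρ (g * k * g⁻¹ * k⁻¹) (ρ k x) = x + ρ g (ρ k x - x) := by
      intro x
      have h1 := h.apply_sub_self_mem hD2 hginv x
      have h2 := hDadd k0 x _ h1
      rw [hkD _ h1, add_sub_cancel] at h2
      have h3 : ρ k (ρ g⁻¹ x) = ρ g⁻¹ x + (ρ k x - x) := by rw [h2]; abel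
      simp only [map_mul, Equiv.Perm.mul_apply]
      rw [map_inv ρ k, Equiv.Perm.coe_inv, Equiv.symm_apply_apply, h3,
        hDadd h0 _ _ (h.apply_sub_self_mem hD2 k0 x), map_inv,
        Equiv.Perm.coe_inv, Equiv.apply_symm_apply]
    have hkS : ∀ x, ρ k x - x ∈ S := by
      intro x
      refine ⟨h.apply_sub_self_mem hD2 k0 x, ?_⟩
      have := hf (g * k * g⁻¹ * k⁻¹)
        (by simp only [map_mul, Equiv.Perm.mul_apply, hkinv, hginv, k0, h0]) (fun y => by
          obtain ⟨y, rfl⟩ := (ρ k).surjective y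
          rw [hcomm]
          have := h.apply_sub_self_mem hD2 k0 y g h0
          convert this using 1
          abel) (ρ k x)
      rw [hcomm] at this
      rw [← sub_eq_iff_eq_add'.mpr this.symm]
    have hkid := hf k k0 fun x => hSC ▸ hkS x
    have headd : ∀ x, φ (e + x) = φ e + φ x := fun x => by
      have := hkid (φ x)
      rw [hk, sub_eq_iff_eq_add'] at this
      exact this
    have hen : ∀ n : ℕ, φ (n • e) = n • φ e := by
      intro n
      induction n with
      | zero => simp [h.apply_zero]
      | succ n ih => rw [succ_nsmul', headd, ih, succ_nsmul']
    intro a u hu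
    rw [← ZMod.natCast_zmod_val a, Nat.cast_smul_eq_nsmul, Nat.cast_smul_eq_nsmul, hen]
    exact StabRel.refl _

theorem liftsLinear_of_faithful [Finite V] (h : BiregularAction p ρ φ) {c : V} (hc0 : c ≠ 0)
    (hc : c ∈ h.fixedModulo ⊥) (hrank : Module.finrank (ZMod p) V ≤ 3)
    (hf : ∀ g, ρ g 0 = 0 → (∀ x, ρ g x - x ∈ ZMod p ∙ c) → ∀ x, ρ g x = x) :
    LiftsLinear ρ φ (ZMod p ∙ c) := by
  intro τ hτ
  by_cases hD : h.fixedModulo (ZMod p ∙ c) = ⊤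
  · have hadd : ∀ x y, φ (x + y) = φ x + φ y := fun x y =>
      h.map_add_of_faithful hf (hD ▸ Submodule.mem_top) x
    refine ⟨linearMapOfAdd φ hadd, fun u => ⟨?_, StabRel.refl _⟩⟩
    obtain ⟨y, hy, g, h0, hg⟩ := hτ u
    convert Submodule.sub_mem _ hy (h.apply_sub_self_mem hD h0 (φ u)) using 1
    rw [hg]
    change φ u - τ u = _
    abel
  · obtain ⟨v, hv⟩ : ∃ v, v ∉ h.fixedModulo (ZMod p ∙ c) := by
      by_contra! hall
      exact hD (eq_top_iff.mpr fun x _ => hall x)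
    obtain ⟨e, rfl⟩ := φ.surjective v
    obtain ⟨y, hy, g, h0, hg⟩ := hτ e
    have hinv : StabInvariant ρ (h.fixedModulo (ZMod p ∙ c)) :=
      h.stabInvariant_of_le (h.le_fixedModulo (h.stabInvariant_of_le_fixed (by simpa using hc)))
        le_rfl
    have hg' : ∀ u, StabRel ρ ((φ.trans (ρ g)) u) (φ u) := fun u => StabRel.symm ⟨g, h0, rfl⟩
    obtain ⟨σ, hσ⟩ := (h.postcomp h0).exists_linear_of_faithful hc0 hc hrank hf τ
      (fun u => by
        obtain ⟨y, hy, hr⟩ := hτ u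
        exact ⟨y, hy, (hg' u).trans hr⟩) (e := e)
      (fun hmem => hv ((stabInvariant_mem_iff hinv (hg' e)).mp hmem))
      (by rw [Equiv.trans_apply, hg, add_sub_cancel_left]; exact hy)
    exact ⟨σ, fun u => ⟨(hσ u).1, (hg' u).symm.trans (hσ u).2⟩⟩

theorem liftsLinear [Finite V] (h : BiregularAction p ρ φ) {c : V} (hc0 : c ≠ 0)
    (hc : c ∈ h.fixedModulo ⊥) (hrank : Module.finrank (ZMod p) V ≤ 3) :
    LiftsLinear ρ φ (ZMod p ∙ c) := by
  induction hn : Module.finrank (ZMod p) V using Nat.strong_induction_on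
    generalizing G U V with
  | _ n ih =>
    by_cases hE : h.kernelFixed (ZMod p ∙ c) = ⊤
    · exact h.liftsLinear_of_faithful hc0 hc hrank fun g h0 hg x =>
        (hE ▸ Submodule.mem_top : x ∈ h.kernelFixed (ZMod p ∙ c)) g h0 hg
    · have hlt := Submodule.finrank_lt hE
      obtain ⟨E', hE'⟩ :=
        h.exists_preimage (h.stabInvariant_kernelFixed (C := ZMod p ∙ c) (by simpa using hc))
      have hE := h.restrict hE'
      refine h.liftsLinear_of_kernelFixed hc hE'
        (ih _ (hn ▸ hlt) hE (fun h0 => hc0 (congrArg Subtype.val h0)) ?_ (by omega) rfl)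
      rw [hE.mem_fixedModulo_bot]
      intro g h0
      exact Subtype.ext (h.mem_fixedModulo_bot.mp hc g (congrArg Subtype.val h0))

/-- The group is generated by the translations of `V` and those of `U`. -/
def IsGenerated (ρ : G →* Equiv.Perm V) (φ : U ≃ V) : Prop :=
  Subgroup.closure {g | (∃ v, ∀ x, ρ g x = v + x) ∨ ∃ u, ∀ x, ρ g (φ x) = φ (u + x)} = ⊤

theorem isGenerated_quotient (h : BiregularAction p ρ φ) (hgen : IsGenerated ρ φ)
    {W : Submodule (ZMod p) V} (hW : StabInvariant ρ W) {W' : Submodule (ZMod p) U}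
    (hW' : ∀ u, u ∈ W' ↔ φ u ∈ W) :
    IsGenerated (h.quotientHom W hW) (h.quotientEquiv hW hW') := by
  rw [IsGenerated, ← top_le_iff, ← hgen]
  refine Subgroup.closure_mono fun g hg => hg.imp ?_ ?_
  · rintro ⟨v, hv⟩
    refine ⟨W.mkQ v, fun x => ?_⟩
    obtain ⟨x, rfl⟩ := W.mkQ_surjective x
    rw [quotientHom_mkQ, hv, map_add]
  · rintro ⟨u, hu⟩
    refine ⟨W'.mkQ u, fun x => ?_⟩
    obtain ⟨x, rfl⟩ := W'.mkQ_surjective x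
    rw [quotientEquiv_mkQ, quotientHom_mkQ, hu, ← map_add, quotientEquiv_mkQ]

theorem apply_add_of_commute (hgen : IsGenerated ρ φ) {u : U}
    (hu : ∀ x, φ (x + u) = φ x + φ u) (g : G) (x : V) : ρ g (x + φ u) = ρ g x + φ u := by
  have hg : g ∈ Subgroup.closure
      {g | (∃ v, ∀ x, ρ g x = v + x) ∨ ∃ u, ∀ x, ρ g (φ x) = φ (u + x)} := by
    rw [show Subgroup.closure _ = ⊤ from hgen]
    exact Subgroup.mem_top g
  induction hg using Subgroup.closure_induction generalizing x with
  | mem g hg =>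
    obtain ⟨v, hv⟩ | ⟨w, hw⟩ := hg
    · rw [hv, hv, add_assoc]
    · obtain ⟨x, rfl⟩ := φ.surjective x
      rw [← hu, hw, hw, ← add_assoc, hu]
  | one => simp
  | mul a b _ _ ha hb => rw [map_mul, Equiv.Perm.mul_apply, Equiv.Perm.mul_apply, hb, ha]
  | inv a _ ha => rw [map_inv, Equiv.Perm.inv_eq_iff_eq, ha]; simp

theorem exists_linear_of_faithful_fixed [Finite V] (h : BiregularAction p ρ φ)
    (hgen : IsGenerated ρ φ)
    (hf : ∀ g, ρ g 0 = 0 → (∀ x, ρ g x - x ∈ h.fixedModulo ⊥) → ∀ x, ρ g x = x) :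
    ∃ σ : U →ₗ[ZMod p] V, ∀ u, StabRel ρ (φ u) (σ u) := by
  have hle : h.fixedModulo (h.fixedModulo ⊥) ≤ h.fixedModulo ⊥ := by
    intro v hv
    obtain ⟨u, rfl⟩ := φ.surjective v
    rw [h.mem_fixedModulo_bot]
    intro g h0
    have := apply_add_of_commute hgen (h.map_add_of_faithful hf hv) g 0
    rwa [h0, zero_add] at this
  have htop : h.fixedModulo ⊥ = ⊤ := by
    by_contra hne
    exact absurd hle (h.lt_fixedModulo (h.stabInvariant_of_le_fixed le_rfl) hne).not_ge
  exact ⟨linearMapOfAdd φ fun x y => h.apply_add_of_map_fixed (htop ▸ Submodule.mem_top) x,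
    fun u => StabRel.refl _⟩

theorem exists_linear_modulo {W : Submodule (ZMod p) V}
    {W' : Submodule (ZMod p) U} (f : U ⧸ W' →ₗ[ZMod p] V ⧸ W) :
    ∃ τ : U →ₗ[ZMod p] V, ∀ u, W.mkQ (τ u) = f (W'.mkQ u) := by
  obtain ⟨s, hs⟩ := LinearMap.exists_rightInverse_of_surjective W.mkQ W.range_mkQ
  exact ⟨s.comp (f.comp W'.mkQ), fun u => LinearMap.congr_fun hs _⟩

/-- A `p`-group acting linearly by precomposition on a nonzero space of functions modulo a subspace
has a nonzero fixed point. -/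
theorem exists_comp_sub_mem [Finite V] (hG : IsPGroup p G) (ρ : G →* Equiv.Perm V)
    {K K' : Submodule (ZMod p) (V → V)} (hlt : K' < K)
    (hK : ∀ g, ∀ k ∈ K, k ∘ ρ g ∈ K) (hK' : ∀ g, ∀ k ∈ K', k ∘ ρ g ∈ K') :
    ∃ k ∈ K, k ∉ K' ∧ ∀ g, k ∘ ρ g - k ∈ K' := by
  let L (g : G) : K →ₗ[ZMod p] K := (LinearMap.funLeft (ZMod p) V (ρ g⁻¹)).restrict (hK g⁻¹)
  let M := K'.comap K.subtype
  let _ : MulAction G (K ⧸ M) :=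
    { smul := fun g => M.mapQ M (L g) fun k hk => hK' g⁻¹ _ hk
      one_smul := fun x => by
        obtain ⟨x, rfl⟩ := M.mkQ_surjective x
        change M.mkQ (L 1 x) = M.mkQ x
        congr 1
        ext v
        change x.1 (ρ 1⁻¹ v) = x.1 v
        simp
      mul_smul := fun a b x => by
        obtain ⟨x, rfl⟩ := M.mkQ_surjective x
        change M.mkQ (L (a * b) x) = M.mkQ (L a (L b x))
        congr 1
        ext v
        change x.1 (ρ (a * b)⁻¹ v) = x.1 (ρ b⁻¹ (ρ a⁻¹ v))
        rw [mul_inv_rev, map_mul, Equiv.Perm.mul_apply] }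
  have hsmul : ∀ (g : G) (k : K), g • M.mkQ k = M.mkQ (L g k) := fun _ _ => rfl
  have hM : M ≠ ⊤ := fun hM => hlt.not_ge fun k hk =>
    (hM ▸ Submodule.mem_top : (⟨k, hk⟩ : K) ∈ M)
  have hcard : p ∣ Nat.card (K ⧸ M) := by
    rw [Module.natCard_eq_pow_finrank (K := ZMod p), Nat.card_zmod]
    refine dvd_pow_self p (Nat.pos_iff_ne_zero.mp ?_)
    have := Submodule.Quotient.nontrivial_iff.mpr hM
    exact Module.finrank_pos
  have h0 : (0 : K ⧸ M) ∈ MulAction.fixedPoints G (K ⧸ M) := fun g => by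
    rw [← map_zero M.mkQ, hsmul, map_zero]
  have : Finite (K ⧸ M) := Finite.of_surjective _ M.mkQ_surjective
  obtain ⟨b, hb, hne⟩ :=
    hG.exists_fixed_point_of_prime_dvd_card_of_fixed_point (K ⧸ M) hcard h0
  obtain ⟨k, rfl⟩ := M.mkQ_surjective b
  refine ⟨k, k.2, fun hk => hne ?_, fun g => ?_⟩
  · rw [eq_comm, Submodule.mkQ_apply, Submodule.Quotient.mk_eq_zero]
    exact hk
  · have := hb g⁻¹
    rw [hsmul, ← sub_eq_zero, ← map_sub, Submodule.mkQ_apply, Submodule.Quotient.mk_eq_zero]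
      at this
    have hk : (L g⁻¹ k - k : K).1 ∈ K' := this
    change k.1 ∘ ρ g⁻¹⁻¹ - k.1 ∈ K' at hk
    rwa [inv_inv] at hk

/-- The displacement functions of elements moving each point by a fixed point of the stabilizer
of `0`. -/
def displacements (h : BiregularAction p ρ φ) : Submodule (ZMod p) (V → V) :=
  submoduleOfAddClosed {k | (∀ x, k x ∈ h.fixedModulo ⊥) ∧ ∃ g, ∀ x, ρ g x = x + k x}
    ⟨fun _ => Submodule.zero_mem _, 1, fun x => by simp⟩ (by
      rintro k ⟨hk, g, hg⟩ l ⟨hl, g', hg'⟩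
      refine ⟨fun x => Submodule.add_mem _ (hk x) (hl x), g * g', fun x => ?_⟩
      rw [map_mul, Equiv.Perm.mul_apply, hg', h.apply_add_of_fixed (hl x), hg, Pi.add_apply,
        add_assoc])

theorem comp_mem_displacements (h : BiregularAction p ρ φ) (g : G) {k : V → V}
    (hk : k ∈ h.displacements) : k ∘ ρ g ∈ h.displacements := by
  obtain ⟨hk, a, ha⟩ := hk
  refine ⟨fun x => hk _, g⁻¹ * a * g, fun x => ?_⟩
  rw [map_mul, map_mul, Equiv.Perm.mul_apply, Equiv.Perm.mul_apply, ha,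
    h.apply_add_of_fixed (hk _)]
  simp

theorem const_mem_displacements (h : BiregularAction p ρ φ) {z : V}
    (hz : z ∈ h.fixedModulo ⊥) : (fun _ => z) ∈ h.displacements := by
  obtain ⟨g, hg⟩ := h.exists_translation z
  exact ⟨fun _ => hz, g, fun x => by rw [hg, add_comm]⟩

theorem apply_eq_zero_of_mem_displacements (h : BiregularAction p ρ φ) {k : V → V}
    (hk : k ∈ h.displacements) (h0 : k 0 = 0) {z : V} (hz : z ∈ h.fixedModulo ⊥) : k z = 0 := by
  obtain ⟨-, g, hg⟩ := hk
  have := h.mem_fixedModulo_bot.mp hz g (by rw [hg, h0, add_zero])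
  rwa [hg, add_eq_left] at this

theorem eq_zero_of_finrank_range_le_one [Finite V] (h : BiregularAction p ρ φ)
    (hR : ∀ c ∈ h.fixedModulo ⊥, c ≠ 0 → h.kernelFixed (ZMod p ∙ c) = ⊤)
    (l : V →ₗ[ZMod p] V) (hl : ⇑l ∈ h.displacements)
    (hrank : Module.finrank (ZMod p) (LinearMap.range l) ≤ 1) : l = 0 := by
  obtain ⟨hlZ, g, hg⟩ := hl
  ext v
  by_contra hv
  have hle : (ZMod p ∙ l v) ≤ LinearMap.range l := by simp
  have heq := Submodule.eq_of_le_of_finrank_le hle (by rwa [finrank_span_singleton hv])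
  have := (hR _ (hlZ v) hv ▸ Submodule.mem_top : v ∈ h.kernelFixed (ZMod p ∙ l v)) g
    (by rw [hg, map_zero, zero_add]) fun x => by
      rw [hg, add_sub_cancel_left, heq]
      exact LinearMap.mem_range_self l x
  rw [hg, add_eq_left] at this
  exact hv this

theorem eq_zero_of_smul_symm {ι : Type*} {a : ι → ZMod p} {f : ι → V}
    (hsymm : ∀ i j, a i • f j = a j • f i) (hf : ∀ c, ∃ j, f j ∉ ZMod p ∙ c) (i : ι) : a i = 0 := by
  by_contra ha
  obtain ⟨j, hj⟩ := hf (f i)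
  refine hj (Submodule.mem_span_singleton.mpr ⟨(a i)⁻¹ * a j, ?_⟩)
  rw [mul_smul, ← hsymm, smul_smul, inv_mul_cancel₀ ha, one_smul]

/-- If no nontrivial element of the stabilizer of `0` moves all points along a single line of
fixed points, but some nontrivial element moves all points by fixed points, there is a linear
displacement map which commutes with the stabilizer. -/
theorem exists_linear_displacement [Finite V] (h : BiregularAction p ρ φ)
    (hR : ∀ c ∈ h.fixedModulo ⊥, c ≠ 0 → h.kernelFixed (ZMod p ∙ c) = ⊤)
    (hrank : Module.finrank (ZMod p) V ≤ 4) {g₀ : G} (hg₀ : ρ g₀ 0 = 0)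
    (hg₀Z : ∀ x, ρ g₀ x - x ∈ h.fixedModulo ⊥) {x₀ : V} (hx₀ : ρ g₀ x₀ ≠ x₀) :
    ∃ l : V →ₗ[ZMod p] V, ⇑l ∈ h.displacements ∧
      (∀ g x, l (ρ g x) = l x + l (ρ g 0)) ∧
      LinearMap.ker l = h.fixedModulo ⊥ ∧
      Module.finrank (ZMod p) (LinearMap.range l) = 2 ∧
      Module.finrank (ZMod p) (h.fixedModulo ⊥) = 2 := by
  let K' : Submodule (ZMod p) (V → V) := submoduleOfAddClosed
    {k | ∃ z ∈ h.fixedModulo ⊥, k = fun _ => z} ⟨0, Submodule.zero_mem _, rfl⟩ (by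
      rintro _ ⟨z, hz, rfl⟩ _ ⟨w, hw, rfl⟩
      exact ⟨z + w, Submodule.add_mem _ hz hw, rfl⟩)
  have hlt : K' < h.displacements := by
    refine lt_of_le_of_ne ?_ fun heq => ?_
    · rintro _ ⟨z, hz, rfl⟩
      exact h.const_mem_displacements hz
    · have : (fun x => ρ g₀ x - x) ∈ h.displacements :=
        ⟨hg₀Z, g₀, fun x => by simp⟩
      rw [← heq] at this
      obtain ⟨z, -, hz⟩ := this
      have h1 := congrFun hz 0
      have h2 := congrFun hz x₀
      simp only [hg₀, sub_zero] at h1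
      rw [← h1, sub_eq_zero] at h2
      exact hx₀ h2
  obtain ⟨k, hk, hkK', hinv⟩ := exists_comp_sub_mem h.isPGroup ρ hlt
    (fun g k hk => h.comp_mem_displacements g hk) (by
      rintro g _ ⟨z, hz, rfl⟩
      exact ⟨z, hz, rfl⟩)
  have hconst : ∀ g x, k (ρ g x) - k x = k (ρ g 0) - k 0 := by
    intro g x
    obtain ⟨z, -, hz⟩ := hinv g
    exact (congrFun hz x).trans (congrFun hz 0).symm
  let l : V →ₗ[ZMod p] V := linearMapOfAdd (fun x => k x - k 0) fun x y => by
    obtain ⟨g, hg⟩ := h.exists_translation x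
    have := hconst g y
    rw [hg, hg, add_zero, sub_eq_iff_eq_add] at this
    rw [this]
    abel
  have hlk : ⇑l = k - fun _ => k 0 := rfl
  have hl : ⇑l ∈ h.displacements := by
    rw [hlk]
    exact Submodule.sub_mem _ hk (h.const_mem_displacements (hk.1 0))
  have hker : h.fixedModulo ⊥ ≤ LinearMap.ker l := fun z hz =>
    h.apply_eq_zero_of_mem_displacements hl l.map_zero hz
  have hrange : LinearMap.range l ≤ h.fixedModulo ⊥ := by
    rintro _ ⟨x, rfl⟩
    exact hl.1 x
  have h2 : ¬ Module.finrank (ZMod p) (LinearMap.range l) ≤ 1 := by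
    intro hle
    have h0 := h.eq_zero_of_finrank_range_le_one hR l hl hle
    refine hkK' ⟨k 0, hk.1 0, ?_⟩
    ext x
    exact sub_eq_zero.mp (LinearMap.congr_fun h0 x)
  have h3 := Submodule.finrank_mono hker
  have h4 := Submodule.finrank_mono hrange
  have h5 := l.finrank_range_add_finrank_ker
  refine ⟨l, hl, fun g x => ?_, (Submodule.eq_of_le_of_finrank_le hker (by omega)).symm,
    by omega, by omega⟩
  change k _ - k 0 = k x - k 0 + (k _ - k 0)
  rw [← hconst g x]
  abel

theorem exists_linear_of_displacement [Finite V] (h : BiregularAction p ρ φ)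
    (hR : ∀ c ∈ h.fixedModulo ⊥, c ≠ 0 → h.kernelFixed (ZMod p ∙ c) = ⊤)
    (hrank : Module.finrank (ZMod p) V ≤ 4)
    (l : V →ₗ[ZMod p] V) (hl : ⇑l ∈ h.displacements)
    (hlg : ∀ g x, l (ρ g x) = l x + l (ρ g 0))
    (hker : LinearMap.ker l = h.fixedModulo ⊥)
    (hl2 : Module.finrank (ZMod p) (LinearMap.range l) = 2)
    (hZ2 : Module.finrank (ZMod p) (h.fixedModulo ⊥) = 2) :
    ∃ σ : U →ₗ[ZMod p] V, ∀ u, StabRel ρ (φ u) (σ u) := by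
  have hline : ∀ c, ∃ x, l x ∉ ZMod p ∙ c := by
    intro c
    by_contra! hall
    have hle : LinearMap.range l ≤ ZMod p ∙ c := by
      rintro _ ⟨x, rfl⟩
      exact hall x
    have h1 := Submodule.finrank_mono hle
    have h2 := finrank_span_le_card (R := ZMod p) ({c} : Set V)
    simp only [Set.toFinset_singleton, Finset.card_singleton] at h2
    omega
  have hFix : h.fixedModulo (h.fixedModulo ⊥) = ⊤ := by
    rw [eq_top_iff]
    intro x _ g h0
    rw [← hker, LinearMap.mem_ker, map_sub, hlg, h0, map_zero, add_zero, sub_self]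
  have hinv := h.stabInvariant_of_le_fixed (le_refl (h.fixedModulo ⊥))
  obtain ⟨Z', hZ'⟩ := h.exists_preimage hinv
  by_cases hfull : ∀ v ∉ h.fixedModulo ⊥, ∀ z ∈ h.fixedModulo ⊥, StabRel ρ v (v + z)
  · obtain ⟨s, hs⟩ := LinearMap.exists_rightInverse_of_surjective (h.fixedModulo ⊥).mkQ
      (h.fixedModulo ⊥).range_mkQ
    have hτ : ∀ u, φ u - s (h.mapModulo hFix u) ∈ h.fixedModulo ⊥ := by
      intro u
      rw [← Submodule.Quotient.mk_eq_zero, ← Submodule.mkQ_apply, map_sub, sub_eq_zero]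
      exact (LinearMap.congr_fun hs (h.mapModulo hFix u)).symm
    obtain ⟨σ, hσ, hσφ⟩ := exists_extend_modulo (E' := Z') (s.comp (h.mapModulo hFix))
      (linearMapOfAdd (fun u => φ u) fun x y =>
        h.apply_add_of_map_fixed ((hZ' y).mp y.2) x) fun u => hτ u
    refine ⟨σ, fun u => ?_⟩
    by_cases hu : u ∈ Z'
    · rw [show σ u = φ u from hσφ ⟨u, hu⟩]
      exact StabRel.refl _
    · have := hfull (φ u) (fun hu' => hu ((hZ' u).mpr hu')) _ (Submodule.sub_mem _ (hσ u) (hτ u))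
      convert this using 1
      simp
  push Not at hfull
  obtain ⟨v₀, hv₀, z₀, hz₀, hz₀v⟩ := hfull
  have hlv₀ : l v₀ ≠ 0 := fun h0 => hv₀ (hker ▸ LinearMap.mem_ker.mpr h0)
  have hk0 : ∀ k ∈ h.displacements, k 0 = 0 → ∃ a : ZMod p, k v₀ = a • l v₀ := by
    let W : Submodule (ZMod p) V := submoduleOfAddClosed
      {z | z ∈ h.fixedModulo ⊥ ∧ StabRel ρ v₀ (v₀ + z)}
      ⟨Submodule.zero_mem _, by simpa using StabRel.refl v₀⟩ (by
        rintro x ⟨hx, hxv⟩ y ⟨hy, hyv⟩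
        refine ⟨Submodule.add_mem _ hx hy, hxv.trans ?_⟩
        have := h.stabRel_add_of_fixed hyv hx
        convert this using 1
        abel)
    have hWk : ∀ k ∈ h.displacements, k 0 = 0 → k v₀ ∈ W := by
      rintro k ⟨hk, g, hg⟩ h0
      exact ⟨hk v₀, g, by rw [hg, h0, add_zero], hg v₀⟩
    have hWlt : W < h.fixedModulo ⊥ := lt_of_le_of_ne (fun x hx => hx.1) fun heq =>
      hz₀v (heq ▸ hz₀ : z₀ ∈ W).2
    have h1 := Submodule.finrank_lt_finrank_of_lt hWlt
    have hle : (ZMod p ∙ l v₀) ≤ W := by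
      simpa using hWk l hl l.map_zero
    have heq := Submodule.eq_of_le_of_finrank_le hle (by
      rw [finrank_span_singleton hlv₀]
      omega)
    intro k hk h0
    obtain ⟨a, ha⟩ := Submodule.mem_span_singleton.mp (heq ▸ hWk k hk h0)
    exact ⟨a, ha.symm⟩
  let K' : Submodule (ZMod p) (V → V) := submoduleOfAddClosed
    {k | ∃ z ∈ h.fixedModulo ⊥, ∃ a : ZMod p, ∀ x, k x = z + a • l x}
    ⟨0, Submodule.zero_mem _, 0, fun x => by simp⟩ (by
      rintro k ⟨z, hz, a, hk⟩ k' ⟨z', hz', a', hk'⟩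
      refine ⟨z + z', Submodule.add_mem _ hz hz', a + a', fun x => ?_⟩
      rw [Pi.add_apply, hk, hk', add_smul]
      abel)
  have hle : K' ≤ h.displacements := by
    rintro k ⟨z, hz, a, hk⟩
    convert Submodule.add_mem _ (h.const_mem_displacements hz) (Submodule.smul_mem _ a hl)
      using 1
    ext x
    exact hk x
  have heq : K' = h.displacements := by
    by_contra hne
    obtain ⟨k, hk, hkK', hkg⟩ := exists_comp_sub_mem h.isPGroup ρ (lt_of_le_of_ne hle hne)
      (fun g k hk => h.comp_mem_displacements g hk) (by
        rintro g k ⟨z, hz, a, hk⟩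
        refine ⟨z + a • l (ρ g 0), Submodule.add_mem _ hz (Submodule.smul_mem _ a (hl.1 _)), a,
          fun x => ?_⟩
        rw [Function.comp_apply, hk, hlg, smul_add]
        abel)
    have hadd : ∀ u, ∃ a : ZMod p, ∀ x, k (u + x) - k 0 = k x - k 0 + (k u - k 0) + a • l x := by
      intro u
      obtain ⟨g, hg⟩ := h.exists_translation u
      obtain ⟨z, hz, a, ha⟩ := hkg g
      refine ⟨a, fun x => ?_⟩
      have h0 := ha 0
      have hx := ha x
      simp only [Pi.sub_apply, Function.comp_apply, hg, add_zero, map_zero, smul_zero] at h0 hx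
      rw [h0, sub_eq_iff_eq_add.mp hx]
      abel
    choose a ha using hadd
    have ha0 : ∀ u, a u = 0 := eq_zero_of_smul_symm (f := l) (fun x y => by
      have h1 := ha x y
      rw [add_comm x y, ha y x, add_comm (k x - k 0), add_right_inj] at h1
      exact h1.symm) hline
    let m : V →ₗ[ZMod p] V := linearMapOfAdd (fun x => k x - k 0) fun x y => by
      rw [ha, ha0, zero_smul, add_zero, add_comm]
    have hm : ⇑m ∈ h.displacements :=
      Submodule.sub_mem _ hk (h.const_mem_displacements (hk.1 0))
    obtain ⟨b, hb⟩ := hk0 m hm m.map_zero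
    have hmb : ⇑(m - b • l) ∈ h.displacements :=
      Submodule.sub_mem _ hm (Submodule.smul_mem _ b hl)
    have hlt : h.fixedModulo ⊥ < LinearMap.ker (m - b • l) := by
      refine lt_of_le_of_ne (fun z hz =>
        h.apply_eq_zero_of_mem_displacements hmb (LinearMap.map_zero _) hz) fun heq => hv₀ ?_
      rw [heq, LinearMap.mem_ker, LinearMap.sub_apply, hb, LinearMap.smul_apply, sub_self]
    have h1 := Submodule.finrank_lt_finrank_of_lt hlt
    have h2 := (m - b • l).finrank_range_add_finrank_ker
    have h3 := h.eq_zero_of_finrank_range_le_one hR _ hmb (by omega)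
    refine hkK' ⟨k 0, hk.1 0, b, fun x => ?_⟩
    have := LinearMap.congr_fun h3 x
    rw [LinearMap.sub_apply, LinearMap.zero_apply, sub_eq_zero] at this
    exact sub_eq_iff_eq_add'.mp this
  have hadd : ∀ u, ∃ a : ZMod p, ∀ x, φ (u + x) = φ x + φ u + a • l (φ x) := by
    intro u
    obtain ⟨g, h0, hg⟩ := h.exists_sub_map u
    have : (fun x => ρ g x - x) ∈ h.displacements :=
      ⟨fun x => h.apply_sub_self_mem hFix h0 x, g, fun x => by simp⟩
    rw [← heq] at this
    obtain ⟨z, -, a, ha⟩ := this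
    have hz := ha 0
    simp only [h0, map_zero, smul_zero, add_zero, sub_zero] at hz
    refine ⟨a, fun x => ?_⟩
    have hx := ha (φ x)
    rw [← hz, zero_add] at hx
    change ρ g (φ x) - φ x = _ at hx
    rw [hg, sub_sub, sub_eq_iff_eq_add] at hx
    rw [hx]
    abel
  choose a ha using hadd
  have ha0 : ∀ u, a u = 0 := eq_zero_of_smul_symm (f := fun u => l (φ u)) (fun x y => by
    have h1 := ha x y
    rw [add_comm x y, ha y x, add_comm (φ x), add_right_inj] at h1
    exact h1.symm) fun c => by
      obtain ⟨x, hx⟩ := hline c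
      obtain ⟨u, rfl⟩ := φ.surjective x
      exact ⟨u, hx⟩
  exact ⟨linearMapOfAdd φ fun x y => by rw [ha, ha0, zero_smul, add_zero, add_comm],
    fun u => StabRel.refl _⟩

theorem exists_linear [Finite V] (h : BiregularAction p ρ φ) (hgen : IsGenerated ρ φ)
    (hrank : Module.finrank (ZMod p) V ≤ 4) :
    ∃ σ : U →ₗ[ZMod p] V, ∀ u, StabRel ρ (φ u) (σ u) := by
  induction hn : Module.finrank (ZMod p) V using Nat.strong_induction_on
    generalizing U V with
  | _ n ih =>
    by_cases hR : ∀ c ∈ h.fixedModulo ⊥, c ≠ 0 → h.kernelFixed (ZMod p ∙ c) = ⊤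
    · by_cases hf : ∀ g, ρ g 0 = 0 → (∀ x, ρ g x - x ∈ h.fixedModulo ⊥) → ∀ x, ρ g x = x
      · exact h.exists_linear_of_faithful_fixed hgen hf
      · push Not at hf
        obtain ⟨g₀, hg₀, hg₀Z, x₀, hx₀⟩ := hf
        obtain ⟨l, hl, hlg, hker, hl2, hZ2⟩ :=
          h.exists_linear_displacement hR hrank hg₀ hg₀Z hx₀
        exact h.exists_linear_of_displacement hR hrank l hl hlg hker hl2 hZ2
    · push Not at hR
      obtain ⟨c, hc, hc0, hE⟩ := hR
      have hC : StabInvariant ρ (ZMod p ∙ c) := h.stabInvariant_of_le_fixed (by simpa using hc)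
      obtain ⟨C', hC'⟩ := h.exists_preimage hC
      have hlt := Submodule.finrank_lt hE
      have hq := Submodule.finrank_quotient_add_finrank (ZMod p ∙ c)
      rw [finrank_span_singleton hc0] at hq
      have : Finite (V ⧸ (ZMod p ∙ c)) := Finite.of_surjective _ (Submodule.mkQ_surjective _)
      obtain ⟨f, hf⟩ := ih _ (by omega) (h.quotient hC hC') (h.isGenerated_quotient hgen hC hC')
        (by omega) rfl
      obtain ⟨τ, hτ⟩ := exists_linear_modulo f
      obtain ⟨E', hE'⟩ :=
        h.exists_preimage (h.stabInvariant_kernelFixed (C := ZMod p ∙ c) (by simpa using hc))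
      have hEr := h.restrict hE'
      obtain ⟨σ, hσ⟩ := h.liftsLinear_of_kernelFixed hc hE'
        (hEr.liftsLinear (fun h0 => hc0 (congrArg Subtype.val h0)) (by
          rw [hEr.mem_fixedModulo_bot]
          intro g h0
          exact Subtype.ext (h.mem_fixedModulo_bot.mp hc g (congrArg Subtype.val h0)))
          (by omega)) τ fun u => h.exists_of_quotient_stabRel hC (by
            rw [hτ]
            exact hf (C'.mkQ u))
      exact ⟨σ, fun u => (hσ u).2⟩

end BiregularAction

section Translations

variable {p : ℕ} [Fact p.Prime] {V : Type*} [AddCommGroup V] [Module (ZMod p) V]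

theorem exists_pSubgroup_of_translations [Finite V] (Q : Subgroup (Equiv.Perm V))
    (g : Equiv.Perm V) (hQ : ∀ v, Equiv.addLeft v ∈ Q)
    (hg : ∀ v, g * Equiv.addLeft v * g⁻¹ ∈ Q) :
    ∃ P : Subgroup (Equiv.Perm V), P ≤ Q ∧ IsPGroup p P ∧ ∃ q ∈ Q, q (g 0) = 0 ∧
      (∀ v, Equiv.addLeft v ∈ P) ∧ ∀ v, (q * g) * Equiv.addLeft v * (q * g)⁻¹ ∈ P := by
  let t : Multiplicative V →* Equiv.Perm V :=
    { toFun := fun v => Equiv.addLeft v.toAdd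
      map_one' := by ext; simp
      map_mul' := fun a b => by ext; simp }
  have hV : IsPGroup p (Multiplicative V) :=
    IsPGroup.of_card (n := Module.finrank (ZMod p) V) (by
      rw [Nat.card_congr Multiplicative.toAdd, Module.natCard_eq_pow_finrank (K := ZMod p),
        Nat.card_zmod])
  have htop : IsPGroup p (⊤ : Subgroup (Multiplicative V)) := hV.to_subgroup _
  let tQ : Multiplicative V →* Q := t.codRestrict Q fun v => hQ v.toAdd
  let cQ : Multiplicative V →* Q :=
    ((MulAut.conj g).toMonoidHom.comp t).codRestrict Q fun v => hg v.toAdd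
  obtain ⟨P, hP⟩ := (htop.map tQ).exists_le_sylow
  obtain ⟨P', hP'⟩ := (htop.map cQ).exists_le_sylow
  obtain ⟨q, hq⟩ := MulAction.exists_smul_eq Q P' P
  have htP : ∀ v, tQ (Multiplicative.ofAdd v) ∈ P := fun v =>
    hP (Subgroup.mem_map_of_mem _ (Subgroup.mem_top _))
  have hcP : ∀ v, q * cQ (Multiplicative.ofAdd v) * q⁻¹ ∈ P := fun v => by
    rw [← hq]
    exact Subgroup.smul_mem_pointwise_smul _ (MulAut.conj q) (P' : Subgroup Q)
      (hP' (Subgroup.mem_map_of_mem _ (Subgroup.mem_top _)))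
  set s : Q := tQ (Multiplicative.ofAdd (-(q.1 (g 0)))) with hs
  refine ⟨(P : Subgroup Q).map Q.subtype, Subgroup.map_subtype_le _, P.isPGroup'.map _,
    (s * q : Q).1, (s * q).2, ?_, fun v => ⟨_, htP v, rfl⟩, fun v => ⟨s * _ * s⁻¹,
      mul_mem (mul_mem (htP _) (hcP v)) (inv_mem (htP _)), ?_⟩⟩
  · change -(q.1 (g 0)) + q.1 (g 0) = 0
    exact neg_add_cancel _
  · change s.1 * (q.1 * (g * Equiv.addLeft v * g⁻¹) * q.1⁻¹) * s.1⁻¹ = _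
    rw [Subgroup.coe_mul]
    group

theorem exists_addAut_of_translations [Finite V] (hrank : Module.finrank (ZMod p) V ≤ 4)
    (Q : Subgroup (Equiv.Perm V)) (g : Equiv.Perm V) (hQ : ∀ v, Equiv.addLeft v ∈ Q)
    (hg : ∀ v, g * Equiv.addLeft v * g⁻¹ ∈ Q) :
    ∃ P : Subgroup (Equiv.Perm V), P ≤ Q ∧ IsPGroup p P ∧ ∃ q ∈ Q, ∃ σ : V ≃+ V,
      ∀ x y, ∃ π ∈ P, π (q (g x)) = σ x ∧ π (q (g y)) = σ y := by
  obtain ⟨P, hPQ, hP, q, hq, hq0, htP, hcP⟩ := exists_pSubgroup_of_translations (p := p) Q g hQ hg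
  set φ : Equiv.Perm V := q * g with hφ
  let k : Set (Equiv.Perm V) :=
    {a | (∃ v, ∀ x, a x = v + x) ∨ ∃ u, ∀ x, a (φ x) = φ (u + x)}
  have hkP : Subgroup.closure k ≤ P := by
    rw [Subgroup.closure_le]
    rintro a (⟨v, hv⟩ | ⟨u, hu⟩)
    · rw [show a = Equiv.addLeft v from Equiv.ext hv]
      exact htP v
    · rw [show a = φ * Equiv.addLeft u * φ⁻¹ by
        ext x
        obtain ⟨x, rfl⟩ := φ.surjective x
        simp [hu]]
      exact hcP u
  have htk : ∀ v, Equiv.addLeft v ∈ Subgroup.closure k := fun v =>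
    Subgroup.subset_closure (Or.inl ⟨v, fun x => rfl⟩)
  have hck : ∀ u, φ * Equiv.addLeft u * φ⁻¹ ∈ Subgroup.closure k := fun u =>
    Subgroup.subset_closure (Or.inr ⟨u, fun x => by simp⟩)
  have h : BiregularAction p (Subgroup.closure k).subtype φ :=
    { isPGroup := hP.to_le hkP
      apply_zero := hq0
      exists_translation := fun v => ⟨⟨_, htk v⟩, fun x => rfl⟩
      exists_conj_translation := fun u => ⟨⟨_, hck u⟩, fun x => by simp⟩ }
  obtain ⟨σ, hσ⟩ := h.exists_linear Subgroup.closure_closure_coe_preimage hrank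
  have hinj : Function.Injective σ := by
    rw [injective_iff_map_eq_zero]
    intro u hu
    obtain ⟨a, ha0, ha⟩ := hσ u
    rw [hu, ← ha0] at ha
    refine φ.injective (((Subgroup.closure k).subtype a).injective ?_)
    rw [ha, h.apply_zero]
  refine ⟨P, hPQ, hP, q, hq, AddEquiv.ofBijective σ (Finite.injective_iff_bijective.mp hinj),
    fun x y => ?_⟩
  obtain ⟨a, ha0, ha⟩ := h.exists_sub_map x
  obtain ⟨b, hb0, hb⟩ := (StabRel.symm ⟨a, ha0, ha (y - x)⟩).trans (hσ (y - x))
  obtain ⟨c, hc⟩ := h.exists_translation (-φ x)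
  obtain ⟨d, hd⟩ := h.exists_translation (σ x)
  have key : ∀ z, (Subgroup.closure k).subtype (d * b * c) (φ z) =
      σ x + (Subgroup.closure k).subtype b (φ z - φ x) := fun z => by
    rw [map_mul, map_mul, Equiv.Perm.mul_apply, Equiv.Perm.mul_apply, hc, hd, neg_add_eq_sub]
  refine ⟨(d * b * c : Subgroup.closure k).1, hkP (d * b * c).2, ?_, ?_⟩
  · refine (key x).trans ?_
    rw [sub_self, hb0, add_zero]
    rfl
  · refine (key y).trans ?_
    rw [add_sub_cancel] at hb
    rw [hb, map_sub, add_sub_cancel]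
    rfl

theorem finrank_eq_of_natCard [Finite V] {r : ℕ} (hcard : Nat.card V = p ^ r) :
    Module.finrank (ZMod p) V = r := by
  rw [Module.natCard_eq_pow_finrank (K := ZMod p), Nat.card_zmod] at hcard
  exact Nat.pow_right_injective (Fact.out : p.Prime).two_le hcard

theorem exists_addAut_of_exponent {V : Type*} [AddCommGroup V] [Finite V]
    (hexp : ∀ x : V, p • x = 0) {r : ℕ} (hcard : Nat.card V = p ^ r) (hr : r ≤ 4)
    (Q : Subgroup (Equiv.Perm V)) (g : Equiv.Perm V) (hQ : ∀ v, Equiv.addLeft v ∈ Q)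
    (hg : ∀ v, g * Equiv.addLeft v * g⁻¹ ∈ Q) :
    ∃ P : Subgroup (Equiv.Perm V), P ≤ Q ∧ IsPGroup p P ∧ ∃ q ∈ Q, ∃ σ : V ≃+ V,
      ∀ x y, ∃ π ∈ P, π (q (g x)) = σ x ∧ π (q (g y)) = σ y := by
  let _ : Module (ZMod p) V := AddCommGroup.zmodModule hexp
  exact exists_addAut_of_translations ((finrank_eq_of_natCard hcard).trans_le hr) Q g hQ hg

end Translations

theorem exists_mulAut_of_translations {p : ℕ} [Fact p.Prime] {H : Type*} [Group H] [Finite H]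
    {r : ℕ} (hr : r ≤ 4) (e : H ≃* (Fin r → Multiplicative (ZMod p)))
    (Q : Subgroup (Equiv.Perm H)) (g : Equiv.Perm H) (hQ : ∀ a, Equiv.mulLeft a ∈ Q)
    (hg : ∀ a, g * Equiv.mulLeft a * g⁻¹ ∈ Q) :
    ∃ P : Subgroup (Equiv.Perm H), P ≤ Q ∧ IsPGroup p P ∧ ∃ q ∈ Q, ∃ σ : MulAut H,
      ∀ x y, ∃ π ∈ P, π (q (g x)) = σ x ∧ π (q (g y)) = σ y := by
  let _ : CommGroup H :=
    { (inferInstance : Group H) with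
      mul_comm := fun a b => e.injective (by rw [map_mul, map_mul, mul_comm]) }
  have hexp : ∀ x : Additive H, p • x = 0 := fun x => by
    refine Additive.toMul.injective (e.injective ?_)
    change e (x.toMul ^ p) = e 1
    rw [map_pow, map_one]
    ext i
    change p • (e x.toMul i).toAdd = 0
    simp
  have hcard : Nat.card (Additive H) = p ^ r := by
    rw [Nat.card_congr (Additive.toMul.trans e.toEquiv), Nat.card_fun,
      Nat.card_congr Multiplicative.toAdd, Nat.card_zmod, Nat.card_fin]
  obtain ⟨P, hPQ, hP, q, hq, σ, hσ⟩ :=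
    exists_addAut_of_exponent (V := Additive H) hexp hcard hr Q g hQ hg
  exact ⟨P, hPQ, hP, q, hq, AddEquiv.toMultiplicative σ, hσ⟩

section Codes

variable {Ω F : Type*}

theorem permAct_mul (a b : Equiv.Perm Ω) (f : Ω → F) :
    permAct (a * b) f = permAct a (permAct b f) := rfl

theorem permAct_inv_self (a : Equiv.Perm Ω) (f : Ω → F) : permAct a⁻¹ (permAct a f) = f := by
  rw [← permAct_mul, inv_mul_cancel]
  rfl

theorem permAct_self_inv (a : Equiv.Perm Ω) (f : Ω → F) : permAct a (permAct a⁻¹ f) = f := by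
  rw [← permAct_mul, mul_inv_cancel]
  rfl

variable [Field F]

/-- The permutations preserving a code. -/
def permAut (J : Submodule F (Ω → F)) : Subgroup (Equiv.Perm Ω) where
  carrier := {π | ∀ f, permAct π f ∈ J ↔ f ∈ J}
  one_mem' := fun f => Iff.rfl
  mul_mem' := fun {a b} ha hb f => by rw [permAct_mul, ha, hb]
  inv_mem' := fun {a} ha f => by rw [← ha, permAct_self_inv]

/-- A code preserved by a group of permutations of order invertible in `F` is the image of an
idempotent matrix which is constant on the orbits of the group on pairs. -/
theorem exists_invariant_matrix [Fintype Ω] [DecidableEq Ω] (J : Submodule F (Ω → F))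
    (P : Subgroup (Equiv.Perm Ω)) (hP : P ≤ permAut J) (hcard : (Nat.card P : F) ≠ 0) :
    ∃ E : Ω → Ω → F, (∀ π ∈ P, ∀ x y, E (π x) (π y) = E x y) ∧
      ∀ f, f ∈ J ↔ ∀ x, ∑ y, E x y * f y = f x := by
  classical
  have := Fintype.ofFinite P
  obtain ⟨T₀, hT₀⟩ := J.subtype.exists_leftInverse_of_injective J.ker_subtype
  let L (π : Equiv.Perm Ω) : (Ω → F) →ₗ[F] (Ω → F) := LinearMap.funLeft F F π.symm
  have hL : ∀ π f, L π f = permAct π f := fun _ _ => rfl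
  let T : (Ω → F) →ₗ[F] (Ω → F) :=
    (Nat.card P : F)⁻¹ • ∑ π : P, L π ∘ₗ J.subtype ∘ₗ T₀ ∘ₗ L (π⁻¹ : P)
  have hT : ∀ f, T f = (Nat.card P : F)⁻¹ •
      ∑ π : P, permAct π.1 (T₀ (permAct π.1⁻¹ f) : Ω → F) := fun f => by
    simp only [T, LinearMap.smul_apply, LinearMap.sum_apply]
    rfl
  have hTJ : ∀ f, T f ∈ J := fun f => by
    rw [hT]
    exact J.smul_mem _ (J.sum_mem fun π _ => (hP π.2 _).mpr (T₀ _).2)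
  have hTf : ∀ f ∈ J, T f = f := fun f hf => by
    have hπ : ∀ π : P, permAct π.1 (T₀ (permAct π.1⁻¹ f) : Ω → F) = f := fun π => by
      have h1 : permAct π.1⁻¹ f ∈ J := (hP (inv_mem π.2) _).mpr hf
      have h2 : T₀ (permAct π.1⁻¹ f) = ⟨_, h1⟩ := LinearMap.congr_fun hT₀ ⟨_, h1⟩
      rw [h2, permAct_self_inv]
    rw [hT, Finset.sum_congr rfl fun π _ => hπ π, Finset.sum_const, Finset.card_univ,
      ← Nat.card_eq_fintype_card, ← Nat.cast_smul_eq_nsmul F, smul_smul, inv_mul_cancel₀ hcard,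
      one_smul]
  have hTP : ∀ π ∈ P, ∀ f, T (permAct π f) = permAct π (T f) := fun π hπ f => by
    rw [hT, hT]
    conv_rhs => rw [← hL π, map_smul, map_sum]
    congr 1
    refine (Fintype.sum_equiv (Equiv.mulLeft (⟨π, hπ⟩ : P)) _ _ fun a => ?_).symm
    change permAct π (permAct a.1 _) = permAct (π * a.1)
      (T₀ (permAct (π * a.1)⁻¹ (permAct π f))).1
    rw [mul_inv_rev, permAct_mul, permAct_mul, permAct_inv_self]
  refine ⟨fun x y => T (Pi.single y 1) x, fun π hπ x y => ?_, fun f => ?_⟩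
  · have h1 : permAct π (Pi.single y (1 : F)) = Pi.single (π y) 1 := by
      ext x
      simp only [permAct, Pi.single_apply, Equiv.symm_apply_eq]
    change T (Pi.single (π y) 1) (π x) = T (Pi.single y 1) x
    rw [← h1, hTP π hπ]
    simp [permAct]
  · have h1 : ∀ x, ∑ y, T (Pi.single y 1) x * f y = T f x := fun x => by
      have h2 : ∀ y, (fun z => if y = z then 1 else 0) = (Pi.single y 1 : Ω → F) := fun y => by
        ext z
        rw [Pi.single_apply]
        simp only [eq_comm]
      conv_rhs => rw [T.pi_apply_eq_sum_univ f]
      simp only [h2, Finset.sum_apply, Pi.smul_apply, smul_eq_mul, mul_comm]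
    simp only [h1]
    exact ⟨fun hf x => by rw [hTf f hf], fun hf => by
      rw [← show T f = f from funext hf]
      exact hTJ f⟩

theorem permAct_mem_iff_of_invariant [Fintype Ω] {J : Submodule F (Ω → F)} {P : Set (Equiv.Perm Ω)}
    {E : Ω → Ω → F} (hE : ∀ π ∈ P, ∀ x y, E (π x) (π y) = E x y)
    (hJ : ∀ f, f ∈ J ↔ ∀ x, ∑ y, E x y * f y = f x) {s t : Equiv.Perm Ω}
    (hst : ∀ x y, ∃ π ∈ P, π (t x) = s x ∧ π (t y) = s y) (f : Ω → F) :
    permAct s f ∈ J ↔ permAct t f ∈ J := by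
  have key : ∀ a : Equiv.Perm Ω, permAct a f ∈ J ↔ ∀ x, ∑ y, E (a x) (a y) * f y = f x := by
    intro a
    rw [hJ, ← a.forall_congr_right]
    refine forall_congr' fun x => ?_
    rw [← Equiv.sum_comp a]
    simp [permAct]
  rw [key, key]
  refine forall_congr' fun x => ?_
  rw [Finset.sum_congr rfl fun y _ => ?_]
  obtain ⟨π, hπ, hx, hy⟩ := hst x y
  rw [← hx, ← hy, hE π hπ]

theorem eq_image_permAct_iff {I J : Submodule F (Ω → F)} (g : Equiv.Perm Ω) :
    (J : Set (Ω → F)) = permAct g '' (I : Set (Ω → F)) ↔ ∀ f, permAct g f ∈ J ↔ f ∈ I := by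
  constructor
  · intro hg f
    rw [← SetLike.mem_coe, hg]
    refine ⟨?_, fun hf => ⟨f, hf, rfl⟩⟩
    rintro ⟨f', hf', heq⟩
    have := congrArg (permAct g⁻¹) heq
    rw [permAct_inv_self, permAct_inv_self] at this
    rwa [← this]
  · intro hg
    ext f
    refine ⟨fun hf => ⟨permAct g⁻¹ f, ?_, permAct_self_inv g f⟩, ?_⟩
    · rw [SetLike.mem_coe, ← hg, permAct_self_inv]
      exact hf
    · rintro ⟨f', hf', rfl⟩
      exact (hg f').mpr hf'

theorem mulLeft_mem_permAut {H : Type*} [Group H] [Fintype H] (hcomm : ∀ a b : H, a * b = b * a)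
    {J : Submodule F (H → F)} (hJ : IsRightIdeal J) (a : H) : Equiv.mulLeft a ∈ permAut J := by
  classical
  have key : ∀ a, ∀ f ∈ J, permAct (Equiv.mulLeft a) f ∈ J := by
    intro a f hf
    convert hJ f hf (Pi.single a 1) using 1
    ext x
    have : ∀ y, f y * (Pi.single a 1 : H → F) (y⁻¹ * x) = if y = a⁻¹ * x then f y else 0 := by
      intro y
      simp only [Pi.single_apply, inv_mul_eq_iff_eq_mul, eq_inv_mul_iff_mul_eq, hcomm a y,
        @eq_comm _ x, mul_ite, mul_one, mul_zero]
    simp [convolve, this, permAct]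
  intro f
  refine ⟨fun hf => ?_, key a f⟩
  have := key a⁻¹ _ hf
  rwa [show Equiv.mulLeft a⁻¹ = (Equiv.mulLeft a)⁻¹ from Equiv.ext fun _ => rfl,
    permAct_inv_self] at this

end Codes

/-- Let `p` be a prime, `H` an elementary abelian `p`-group of rank
at most four, and `F` a finite field of characteristic different from `p`.  Then `H`
is a CI-group with respect to semisimple group codes: any two permutation-equivalent
right ideals of `F[H]` are equivalent via a group automorphism of `H`. -/
theorem elementary_abelian_rank_le_four_CI_for_semisimple_codes
    {p : ℕ} (hp : p.Prime)
    {H F : Type*} [Group H] [Fintype H] [DecidableEq H]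
    (hH : ∃ r : ℕ, 1 ≤ r ∧ r ≤ 4 ∧
      Nonempty (H ≃* (Fin r → Multiplicative (ZMod p))))
    [Field F] [Fintype F] (hchar : ringChar F ≠ p) :
    ∀ I J : Submodule F (H → F), IsRightIdeal I → IsRightIdeal J →
      (∃ g : Equiv.Perm H, (J : Set (H → F)) = permAct g '' (I : Set (H → F))) →
      ∃ σ : MulAut H, (J : Set (H → F)) = permAct σ.toEquiv '' (I : Set (H → F)) := by
  intro I J hI hJ ⟨g, hg⟩
  have := Fact.mk hp
  obtain ⟨r, -, hr, ⟨e⟩⟩ := hH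
  have hcomm : ∀ a b : H, a * b = b * a := fun a b =>
    e.injective (by rw [map_mul, map_mul, mul_comm])
  rw [eq_image_permAct_iff] at hg
  obtain ⟨P, hPJ, hP, q, hq, σ, hσ⟩ := exists_mulAut_of_translations hr e (permAut J) g
    (mulLeft_mem_permAut hcomm hJ) (fun a f => by
      rw [permAct_mul, permAct_mul, hg, mulLeft_mem_permAut hcomm hI a, ← hg, permAct_self_inv])
  have hcard : (Nat.card P : F) ≠ 0 := by
    obtain ⟨n, hn⟩ := IsPGroup.iff_card.mp hP
    rw [hn, Nat.cast_pow]
    refine pow_ne_zero n fun h0 => ?_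
    obtain h1 | h1 := (Nat.dvd_prime hp).mp ((ringChar.spec F p).mp h0)
    · exact CharP.ringChar_ne_one h1
    · exact hchar h1
  obtain ⟨E, hE, hEJ⟩ := exists_invariant_matrix J P hPJ hcard
  refine ⟨σ, (eq_image_permAct_iff σ.toEquiv).mpr fun f => ?_⟩
  rw [permAct_mem_iff_of_invariant (P := P) (s := σ.toEquiv) (t := q * g) hE hEJ hσ, permAct_mul,
    hq, hg]
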